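/- arXiv:2410.13555 — 3 statements merged into one kernel-verified Lean document; each statement's English description precedes it below -/
import Mathlib

section
/- A non-negative integer N can be written as N = l² + m² + 4·t_n with l,m ∈ ℤ and n ∈ ℕ if and only if N is not of the form 4k+3 for some k ∈ ℕ. -/
/-- The `n`-th triangular number `n(n+1)/2`. -/
def tri (n : ℕ) : ℕ := n * (n + 1) / 2

/-- The `n`-th generalized pentagonal number `n(3n+1)/2` (`n ∈ ℤ`). -/
def pent (n : ℤ) : ℤ := n * (3 * n + 1) / 2

/-- The `n`-th generalized octagonal number `n(3n+2)` (`n ∈ ℤ`). -/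
def oct (n : ℤ) : ℤ := n * (3 * n + 2)
noncomputable def rCount (a b c : ℕ) (N : ℤ) : ℕ :=
  {x : ℤ × ℤ × ℤ | N = a * x.1 ^ 2 + b * x.2.1 ^ 2 + c * x.2.2 ^ 2}.ncard

noncomputable def TCount (a b c : ℕ) (N : ℤ) : ℕ :=
  {x : ℕ × ℕ × ℕ | N = a * tri x.1 + b * tri x.2.1 + c * tri x.2.2}.ncard

noncomputable def rTCount (a b c : ℕ) (N : ℤ) : ℕ :=
  {x : ℤ × ℕ × ℕ | N = a * x.1 ^ 2 + b * tri x.2.1 + c * tri x.2.2}.ncard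

noncomputable def RtCount (a b c : ℕ) (N : ℤ) : ℕ :=
  {x : ℤ × ℤ × ℕ | N = a * x.1 ^ 2 + b * x.2.1 ^ 2 + c * tri x.2.2}.ncard

noncomputable def GCount (a b c : ℕ) (N : ℤ) : ℕ :=
  {x : ℤ × ℤ × ℤ | N = a * oct x.1 + b * oct x.2.1 + c * oct x.2.2}.ncard

noncomputable def RgCount (a b c : ℕ) (N : ℤ) : ℕ :=
  {x : ℤ × ℤ × ℤ | N = a * x.1 ^ 2 + b * x.2.1 ^ 2 + c * oct x.2.2}.ncard

noncomputable def RpCount (a b c : ℕ) (N : ℤ) : ℕ :=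
  {x : ℤ × ℤ × ℤ | N = a * x.1 ^ 2 + b * x.2.1 ^ 2 + c * pent x.2.2}.ncard

noncomputable def rPCount (a b c : ℕ) (N : ℤ) : ℕ :=
  {x : ℤ × ℤ × ℤ | N = a * x.1 ^ 2 + b * pent x.2.1 + c * pent x.2.2}.ncard

noncomputable def rGCount (a b c : ℕ) (N : ℤ) : ℕ :=
  {x : ℤ × ℤ × ℤ | N = a * x.1 ^ 2 + b * oct x.2.1 + c * oct x.2.2}.ncard

noncomputable def pGCount (a b c : ℕ) (N : ℤ) : ℕ :=
  {x : ℤ × ℤ × ℤ | N = a * pent x.1 + b * oct x.2.1 + c * oct x.2.2}.ncard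

noncomputable def TpCount (a b c : ℕ) (N : ℤ) : ℕ :=
  {x : ℕ × ℕ × ℤ | N = a * tri x.1 + b * tri x.2.1 + c * pent x.2.2}.ncard

noncomputable def TgCount (a b c : ℕ) (N : ℤ) : ℕ :=
  {x : ℕ × ℕ × ℤ | N = a * tri x.1 + b * tri x.2.1 + c * oct x.2.2}.ncard

noncomputable def tGCount (a b c : ℕ) (N : ℤ) : ℕ :=
  {x : ℕ × ℤ × ℤ | N = a * tri x.1 + b * oct x.2.1 + c * oct x.2.2}.ncard

noncomputable def rtpCount (a b c : ℕ) (N : ℤ) : ℕ :=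
  {x : ℤ × ℕ × ℤ | N = a * x.1 ^ 2 + b * tri x.2.1 + c * pent x.2.2}.ncard

noncomputable def rtgCount (a b c : ℕ) (N : ℤ) : ℕ :=
  {x : ℤ × ℕ × ℤ | N = a * x.1 ^ 2 + b * tri x.2.1 + c * oct x.2.2}.ncard

noncomputable def tpgCount (a b c : ℕ) (N : ℤ) : ℕ :=
  {x : ℕ × ℤ × ℤ | N = a * tri x.1 + b * pent x.2.1 + c * oct x.2.2}.ncard

/-- Reduction of positive binary forms. -/
theorem binary_red (D : ℤ) (hD : 0 < D) : ∀ (k : ℕ) (a b c : ℤ), a.toNat ≤ k → 0 < a →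
    a * c - b ^ 2 = D →
    ∃ p q r s : ℤ, p * s - q * r = 1 ∧ 0 < a * p ^ 2 + 2 * b * p * r + c * r ^ 2 ∧
      3 * (a * p ^ 2 + 2 * b * p * r + c * r ^ 2) ^ 2 ≤ 4 * D := by
  intro k
  induction k with
  | zero => intro a b c h1 h2; omega
  | succ k ih =>
    intro a b c hk ha hdet
    obtain ⟨t, ht1, ht2⟩ : ∃ t : ℤ, 2 * (b + t * a) ≤ a ∧ -a ≤ 2 * (b + t * a) := by
      refine ⟨-((2 * b + a) / (2 * a)), ?_, ?_⟩
      · have := Int.lt_mul_ediv_self_add (x := 2 * b + a) (k := 2 * a) (by omega)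
        nlinarith
      · have := Int.mul_ediv_self_le (x := 2 * b + a) (k := 2 * a) (by omega)
        nlinarith
    obtain ⟨b', hb'⟩ : ∃ b', b' = b + t * a := ⟨_, rfl⟩
    obtain ⟨c', hc'⟩ : ∃ c', c' = c + 2 * b * t + a * t ^ 2 := ⟨_, rfl⟩
    rw [← hb'] at ht1 ht2
    have hdet' : a * c' - b' ^ 2 = D := by rw [hb', hc', ← hdet]; ring
    have hc'pos : 0 < c' := by
      by_contra h
      push Not at h
      nlinarith [sq_nonneg b', mul_nonneg ha.le (neg_nonneg.2 h)]
    by_cases hlt : c' < a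
    · obtain ⟨p, q, r, s, h1, h2, h3⟩ := ih c' (-b') a (by omega) hc'pos (by rw [← hdet']; ring)
      have key : a * (t * p - r) ^ 2 + 2 * b * (t * p - r) * p + c * p ^ 2
          = c' * p ^ 2 + 2 * (-b') * p * r + a * r ^ 2 := by rw [hb', hc']; ring
      refine ⟨t * p - r, t * q - s, p, q, by linarith, ?_, ?_⟩
      · rw [key]; exact h2
      · rw [key]; exact h3
    · refine ⟨1, 0, 0, 1, by ring, by simpa using ha, ?_⟩
      push Not at hlt
      have : 4 * b' ^ 2 ≤ a ^ 2 := by nlinarith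
      nlinarith

theorem terminal (a b f : ℤ) (ha : 0 < a) (hlt : a ≤ b) (ht1 : 2 * f ≤ a) (ht2 : -a ≤ 2 * f)
    (hle : 3 * (a * b - f ^ 2) ^ 2 ≤ 4 * a) : a = 1 ∧ f = 0 ∧ b = 1 := by
  have h4 : 4 * f ^ 2 ≤ a ^ 2 := by nlinarith
  have h4' : a * a ≤ a * b := mul_le_mul_of_nonneg_left hlt ha.le
  have h5 : 3 * a ^ 2 ≤ 4 * (a * b - f ^ 2) := by linarith
  have ha1 : a = 1 := by
    by_contra hne
    have h2 : 2 ≤ a := by omega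
    have h6 : (3 * a ^ 2) ^ 2 ≤ (4 * (a * b - f ^ 2)) ^ 2 :=
      pow_le_pow_left₀ (by positivity) h5 2
    have h7 : a * (27 * a ^ 3) ≤ a * 64 := by linarith
    have h8 : 27 * a ^ 3 ≤ 64 := le_of_mul_le_mul_left h7 ha
    have h9 : 2 ^ 3 ≤ a ^ 3 := pow_le_pow_left₀ (by norm_num) h2 3
    linarith
  have hf0 : f = 0 := by omega
  subst ha1 hf0
  refine ⟨rfl, rfl, ?_⟩
  nlinarith

/-- Positive ternary forms of determinant one represent only sums of three squares. -/
theorem ternary_red : ∀ (k : ℕ) (a b c d e f : ℤ), a.toNat ≤ k → 0 < a → 0 < a * b - f ^ 2 →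
    a * b * c + 2 * d * e * f - a * d ^ 2 - b * e ^ 2 - c * f ^ 2 = 1 →
    ∀ x y z : ℤ, ∃ u v w : ℤ,
      a * x ^ 2 + b * y ^ 2 + c * z ^ 2 + 2 * d * y * z + 2 * e * x * z + 2 * f * x * y
        = u ^ 2 + v ^ 2 + w ^ 2 := by
  intro k
  induction k with
  | zero => intro a b c d e f h1 h2; omega
  | succ k ih =>
    intro a b c d e f hk ha hg hdet x y z
    obtain ⟨p, q, r, s, hps, hpos, hle⟩ := binary_red a ha _ (a * b - f ^ 2) (a * d - e * f)
      (a * c - e ^ 2) le_rfl hg (by linear_combination a * hdet)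
    obtain ⟨f₁, hf₁⟩ : ∃ f₁, f₁ = f * p + e * r := ⟨_, rfl⟩
    obtain ⟨t, ht1, ht2⟩ : ∃ t : ℤ, 2 * (f₁ + t * a) ≤ a ∧ -a ≤ 2 * (f₁ + t * a) := by
      refine ⟨-((2 * f₁ + a) / (2 * a)), ?_, ?_⟩
      · have := Int.lt_mul_ediv_self_add (x := 2 * f₁ + a) (k := 2 * a) (by omega)
        nlinarith
      · have := Int.mul_ediv_self_le (x := 2 * f₁ + a) (k := 2 * a) (by omega)
        nlinarith
    obtain ⟨f', hf'⟩ : ∃ f', f' = f₁ + t * a := ⟨_, rfl⟩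
    rw [← hf'] at ht1 ht2
    subst hf₁
    obtain ⟨e', he'⟩ : ∃ e', e' = f * q + e * s := ⟨_, rfl⟩
    obtain ⟨b', hb'⟩ : ∃ b', b' = b * p ^ 2 + 2 * d * p * r + c * r ^ 2
      + 2 * t * (f * p + e * r) + a * t ^ 2 := ⟨_, rfl⟩
    obtain ⟨c', hc'⟩ : ∃ c', c' = b * q ^ 2 + 2 * d * q * s + c * s ^ 2 := ⟨_, rfl⟩
    obtain ⟨d', hd'⟩ : ∃ d', d' = b * p * q + d * (p * s + q * r) + c * r * s
      + t * (f * q + e * s) := ⟨_, rfl⟩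
    have hG : (a * b - f ^ 2) * p ^ 2 + 2 * (a * d - e * f) * p * r + (a * c - e ^ 2) * r ^ 2
        = a * b' - f' ^ 2 := by rw [hb', hf']; ring
    rw [hG] at hpos hle
    have hdet' : a * b' * c' + 2 * d' * e' * f' - a * d' ^ 2 - b' * e' ^ 2 - c' * f' ^ 2 = 1 := by
      have : a * b' * c' + 2 * d' * e' * f' - a * d' ^ 2 - b' * e' ^ 2 - c' * f' ^ 2
        = (a * b * c + 2 * d * e * f - a * d ^ 2 - b * e ^ 2 - c * f ^ 2) * (p * s - q * r) ^ 2 := by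
        rw [hb', hc', hd', he', hf']; ring
      rw [this, hdet, hps]; norm_num
    have hb'pos : 0 < b' := by
      by_contra h
      push Not at h
      nlinarith [sq_nonneg f', mul_nonneg ha.le (neg_nonneg.2 h)]
    obtain ⟨Y, hY⟩ : ∃ Y, Y = s * y - q * z := ⟨_, rfl⟩
    obtain ⟨Z, hZ⟩ : ∃ Z, Z = p * z - r * y := ⟨_, rfl⟩
    obtain ⟨X, hX⟩ : ∃ X, X = x - t * Y := ⟨_, rfl⟩
    have hy : y = p * Y + q * Z := by rw [hY, hZ]; linear_combination (-y) * hps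
    have hz : z = r * Y + s * Z := by rw [hY, hZ]; linear_combination (-z) * hps
    have hx : x = X + t * Y := by rw [hX]; ring
    have key : a * x ^ 2 + b * y ^ 2 + c * z ^ 2 + 2 * d * y * z + 2 * e * x * z + 2 * f * x * y
        = a * X ^ 2 + b' * Y ^ 2 + c' * Z ^ 2 + 2 * d' * Y * Z + 2 * e' * X * Z
          + 2 * f' * X * Y := by
      clear hY hZ hX
      rw [hx, hy, hz, hb', hc', hd', he', hf']; ring
    rw [key]
    by_cases hlt : b' < a
    · obtain ⟨u, v, w, h⟩ := ih b' a c' e' d' f' (by omega) hb'pos (by linarith) (by linarith) Y X Z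
      exact ⟨u, v, w, by rw [← h]; ring⟩
    · push Not at hlt
      obtain ⟨ha1, hf0, hb1⟩ := terminal a b' f' ha hlt ht1 ht2 hle
      rw [ha1, hf0, hb1] at hdet' ⊢
      refine ⟨X + e' * Z, Y + d' * Z, Z, ?_⟩
      linear_combination Z ^ 2 * hdet'

theorem jac_aux (n b p : ℕ) (hp2 : 2 * p + 1 = b * n)
    (hb : b % 8 = 1 ∨ b % 8 = 3) (hpb : p % 4 = 1 ∨ (p % 4 = 3 ∧ b % 4 = 3)) :
    jacobiSym (-(b : ℤ)) p = 1 := by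
  have hbo : Odd b := Nat.odd_iff.2 (by omega)
  have hpo : Odd p := Nat.odd_iff.2 (by omega)
  have h1 : jacobiSym (-2 * (p : ℤ)) b = 1 := by
    rw [jacobiSym.mod_left' (a₂ := 1), jacobiSym.one_left]
    have h : (2 * p + 1 : ℤ) = b * n := by exact_mod_cast hp2
    exact (Int.emod_emod_of_dvd _ (dvd_refl _)).symm.trans
      (by rw [show -2 * (p : ℤ) = 1 + b * (-n) by linarith, Int.add_mul_emod_self_left, Int.emod_emod_of_dvd _ (dvd_refl _)])
  have h2 : jacobiSym (-2) b = 1 := by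
    rw [jacobiSym.at_neg_two hbo, ZMod.χ₈'_nat_eq_if_mod_eight]
    have : b % 2 ≠ 0 := by omega
    simp [this, hb]
  rw [jacobiSym.mul_left, h2, one_mul] at h1
  rw [jacobiSym.neg _ hpo]
  rcases hpb with h | ⟨h, h'⟩
  · rw [ZMod.χ₄_nat_one_mod_four h, one_mul, ← jacobiSym.quadratic_reciprocity_one_mod_four h hbo, h1]
  · rw [ZMod.χ₄_nat_three_mod_four h, jacobiSym.quadratic_reciprocity_three_mod_four h' h, h1]
    norm_num

theorem three_sq_of (n c : ℕ) (hn : 2 ≤ n) (hc : c % 8 = 1 ∨ c % 8 = 3) (r : ℕ)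
    (hr : 2 * r + 1 = c * n) (hrc : r % 4 = 1 ∨ (r % 4 = 3 ∧ c % 4 = 3)) :
    ∃ u v w : ℤ, (n : ℤ) = u ^ 2 + v ^ 2 + w ^ 2 := by
  have hco : Nat.Coprime r (4 * n) := by
    apply Nat.Coprime.mul_right
    · have : Nat.Coprime r 2 := (Nat.odd_iff.2 (by omega)).coprime_two_right
      exact this.pow_right 2
    · rw [← Nat.isCoprime_iff_coprime]
      exact ⟨-2, c, by push_cast; have : (2 * r + 1 : ℤ) = c * n := by exact_mod_cast hr
                       linarith⟩
  have : NeZero (4 * n) := ⟨by omega⟩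
  obtain ⟨p, hpr, hp, hpm⟩ := Nat.forall_exists_prime_gt_and_modEq r (q := 4 * n) (by omega) hco
  obtain ⟨v, hv⟩ : 4 * n ∣ p - r := (Nat.modEq_iff_dvd' hpr.le).1 hpm.symm
  have hpv : p = 4 * n * v + r := by omega
  have hp4 : p % 4 = r % 4 := by rw [hpv, mul_assoc]; omega
  obtain ⟨b, hb⟩ : ∃ b, b = 8 * v + c := ⟨_, rfl⟩
  have hbn : 2 * p + 1 = b * n := by rw [hpv, hb]; linarith
  have hj := jac_aux n b p hbn (by omega) (by omega)
  haveI : Fact p.Prime := ⟨hp⟩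
  have hx : ∃ x : ℤ, (p : ℤ) ∣ x ^ 2 + b := by
    rw [← jacobiSym.legendreSym.to_jacobiSym] at hj
    have h0 : ((-(b : ℤ) : ℤ) : ZMod p) ≠ 0 := by
      intro h
      rw [(legendreSym.eq_zero_iff p _).2 h] at hj
      norm_num at hj
    obtain ⟨y, hy⟩ := (legendreSym.eq_one_iff p h0).1 hj
    obtain ⟨x, rfl⟩ := ZMod.intCast_surjective y
    refine ⟨x, ?_⟩
    rw [← ZMod.intCast_zmod_eq_zero_iff_dvd]
    push_cast at hy ⊢
    linear_combination -hy
  have hx2 : ∃ x : ℤ, (2 * p : ℤ) ∣ x ^ 2 + b := by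
    obtain ⟨x, hx⟩ := hx
    have aux : ∀ x : ℤ, Odd x → (p : ℤ) ∣ x ^ 2 + b → (2 * p : ℤ) ∣ x ^ 2 + b := by
      intro x hxo hd
      apply IsCoprime.mul_dvd _ _ hd
      · rw [show (2 : ℤ) = (2 : ℕ) by rfl, Nat.isCoprime_iff_coprime]
        exact (Nat.odd_iff.2 (by omega)).coprime_two_left
      · have hbo : Odd (b : ℤ) := by
          have : Odd b := Nat.odd_iff.2 (by omega)
          exact_mod_cast this
        exact (hxo.pow.add_odd hbo).two_dvd
    rcases Int.even_or_odd x with h | h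
    · refine ⟨x + p, aux _ (h.add_odd ?_) ?_⟩
      · have : Odd p := Nat.odd_iff.2 (by omega)
        exact_mod_cast this
      · have : (x + p) ^ 2 + b = (x ^ 2 + b) + p * (2 * x + p) := by ring
        rw [this]
        exact dvd_add hx (dvd_mul_right _ _)
    · exact ⟨x, aux x h hx⟩
  obtain ⟨x, t, ht⟩ := hx2
  have hbn' : (2 * p + 1 : ℤ) = b * n := by exact_mod_cast hbn
  have hbpos : (0 : ℤ) < b := by omega
  obtain ⟨u, w, z, h⟩ := ternary_red _ (2 * p) t n 1 0 x le_rfl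
    (by have := hp.pos; omega) (by rw [← ht]; linarith)
    (by linear_combination (-n : ℤ) * ht - hbn') 0 0 1
  exact ⟨u, w, z, by rw [← h]; ring⟩

theorem three_sq (n : ℕ) (h : n % 8 = 1 ∨ n % 8 = 3 ∨ n % 8 = 5) :
    ∃ u v w : ℤ, (n : ℤ) = u ^ 2 + v ^ 2 + w ^ 2 := by
  by_cases h1 : n = 1
  · exact ⟨1, 0, 0, by simp [h1]⟩
  rcases h with h | h | h
  · exact three_sq_of n 3 (by omega) (by omega) ((3 * n - 1) / 2) (by omega) (by omega)
  · exact three_sq_of n 1 (by omega) (by omega) ((n - 1) / 2) (by omega) (by omega)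
  · exact three_sq_of n 3 (by omega) (by omega) ((3 * n - 1) / 2) (by omega) (by omega)

theorem tri_eq (n : ℕ) : (2 * tri n : ℤ) = n * (n + 1) := by
  have : 2 * tri n = n * (n + 1) := Nat.mul_div_cancel' (Nat.even_mul_succ_self n).two_dvd
  exact_mod_cast this

theorem of_odd (N : ℕ) (u v w : ℤ) (h : (2 * N + 1 : ℤ) = u ^ 2 + v ^ 2 + w ^ 2)
    (hw : w % 2 = 1) (huv : (u + v) % 2 = 0) :
    ∃ (l m : ℤ) (n : ℕ), (N : ℤ) = l ^ 2 + m ^ 2 + 4 * tri n := by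
  obtain ⟨l, hl⟩ : ∃ l, u + v = 2 * l := ⟨(u + v) / 2, by omega⟩
  obtain ⟨n, hn⟩ : ∃ n : ℕ, w ^ 2 = (2 * n + 1) ^ 2 := by
    rcases le_total 0 w with h0 | h0
    · exact ⟨(w / 2).toNat, by congr 1; omega⟩
    · exact ⟨((-w) / 2).toNat, by rw [← neg_sq w]; congr 1; omega⟩
  refine ⟨l, u - l, n, ?_⟩
  have h2 := tri_eq n
  have hv : v = 2 * l - u := by linarith
  subst hv
  nlinarith

theorem stmt2 (N : ℕ) :
    (∃ (l m : ℤ) (n : ℕ), (N : ℤ) = l ^ 2 + m ^ 2 + 4 * tri n) ↔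
      ¬ ∃ k : ℕ, N = 4 * k + 3 := by
  constructor
  · rintro ⟨l, m, n, h⟩ ⟨k, rfl⟩
    have hl : l ^ 2 % 4 = 0 ∨ l ^ 2 % 4 = 1 := by
      rcases Int.even_or_odd' l with ⟨j, rfl | rfl⟩ <;> ring_nf <;> omega
    have hm : m ^ 2 % 4 = 0 ∨ m ^ 2 % 4 = 1 := by
      rcases Int.even_or_odd' m with ⟨j, rfl | rfl⟩ <;> ring_nf <;> omega
    push_cast at h
    omega
  · intro h
    have h3 : N % 4 ≠ 3 := fun h' => h ⟨N / 4, by omega⟩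
    obtain ⟨u, v, w, hs⟩ := three_sq (2 * N + 1) (by omega)
    push_cast at hs
    have par : ∀ a : ℤ, a ^ 2 % 2 = a % 2 := by
      intro a
      rcases Int.even_or_odd' a with ⟨j, rfl | rfl⟩ <;> ring_nf <;> omega
    have hu := par u
    have hv := par v
    have hw := par w
    by_cases c1 : w % 2 = 1
    · exact of_odd N u v w hs c1 (by omega)
    by_cases c2 : v % 2 = 1
    · exact of_odd N u w v (by linarith) c2 (by omega)
    · exact of_odd N w v u (by linarith) (by omega) (by omega)
end

section
/- Every positive odd integer N can be written as N = l² + m² + 2·n² with l,m,n ∈ ℤ. -/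
lemma aux_shift (a f : ℤ) (ha : 0 < a) : ∃ k : ℤ, 4 * (f + k * a) ^ 2 ≤ a ^ 2 := by
  refine ⟨-((2 * f + a) / (2 * a)), ?_⟩
  have h1 := Int.emod_add_mul_ediv (2 * f + a) (2 * a)
  have h2 := Int.emod_nonneg (2 * f + a) (show 2 * a ≠ 0 by omega)
  have h3 := Int.emod_lt_of_pos (2 * f + a) (show 0 < 2 * a by omega)
  generalize (2 * f + a) / (2 * a) = q at *
  generalize (2 * f + a) % (2 * a) = r at *
  have h4 : 2 * (f + -q * a) = r - a := by linarith
  have h5 : 4 * (f + -q * a) ^ 2 = (r - a) ^ 2 := by rw [← h4]; ring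
  rw [h5]
  nlinarith

/-- Reduction of positive definite integral ternary forms of determinant one. -/
lemma aux_reduce : ∀ A D : ℕ, ∀ a b c d e f : ℤ, a = A → a * b - f ^ 2 = D → 0 < a →
    0 < a * b - f ^ 2 →
    a * b * c + 2 * d * e * f - a * d ^ 2 - b * e ^ 2 - c * f ^ 2 = 1 →
    ∀ x y z : ℤ, ∃ l m n : ℤ,
      a * x ^ 2 + b * y ^ 2 + c * z ^ 2 + 2 * d * y * z + 2 * e * x * z + 2 * f * x * y
        = l ^ 2 + m ^ 2 + n ^ 2 := by
  intro A
  induction A using Nat.strong_induction_on with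
  | _ A ihA =>
  intro D
  induction D using Nat.strong_induction_on with
  | _ D ihD =>
  intro a b c d e f hA hD ha hpos hdet x y z
  obtain ⟨k, hk⟩ := aux_shift a f ha
  have hD1 : a * (b + 2 * k * f + k ^ 2 * a) - (f + k * a) ^ 2 = a * b - f ^ 2 := by ring
  have hb1 : 0 < b + 2 * k * f + k ^ 2 * a := by
    have : 0 < a * (b + 2 * k * f + k ^ 2 * a) := by nlinarith [sq_nonneg (f + k * a)]
    exact pos_of_mul_pos_right this ha.le
  by_cases hlt : b + 2 * k * f + k ^ 2 * a < a
  · obtain ⟨l, m, n, h⟩ := ihA (b + 2 * k * f + k ^ 2 * a).toNat (by omega)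
      (a * b - f ^ 2).toNat (b + 2 * k * f + k ^ 2 * a) a c e (d + k * e) (f + k * a)
      (by omega) (by rw [Int.toNat_of_nonneg hpos.le]; ring) hb1
      (by linarith [mul_comm a (b + 2 * k * f + k ^ 2 * a)])
      (by rw [← hdet]; ring) y (x - k * y) z
    exact ⟨l, m, n, by rw [← h]; ring⟩
  have h1 : 3 * a ^ 2 ≤ 4 * (a * b - f ^ 2) := by nlinarith
  obtain ⟨j, hj⟩ := aux_shift (a * b - f ^ 2) (a * d - e * f) hpos
  have hD2 : (a * b - f ^ 2) * (a * (c + 2 * j * d + j ^ 2 * b) - (e + j * f) ^ 2)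
      = (a * d - e * f + j * (a * b - f ^ 2)) ^ 2 + a := by
    linear_combination a * hdet
  have hb2 : 0 < a * (c + 2 * j * d + j ^ 2 * b) - (e + j * f) ^ 2 := by
    have : 0 < (a * b - f ^ 2) * (a * (c + 2 * j * d + j ^ 2 * b) - (e + j * f) ^ 2) := by
      rw [hD2]; positivity
    exact pos_of_mul_pos_right this hpos.le
  by_cases hlt2 : a * (c + 2 * j * d + j ^ 2 * b) - (e + j * f) ^ 2 < a * b - f ^ 2
  · obtain ⟨l, m, n, h⟩ := ihD (a * (c + 2 * j * d + j ^ 2 * b) - (e + j * f) ^ 2).toNat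
      (by omega)
      a (c + 2 * j * d + j ^ 2 * b) b (d + j * b) f (e + j * f)
      hA (by rw [Int.toNat_of_nonneg hb2.le]) ha hb2
      (by rw [← hdet]; ring) x z (y - j * z)
    exact ⟨l, m, n, by rw [← h]; ring⟩
  have h2 : 3 * (a * b - f ^ 2) ^ 2 ≤ 4 * a := by nlinarith
  have ha1 : a = 1 := by
    by_contra hne
    have h3 : 2 ≤ a := by omega
    have h4 : (3 * a ^ 2) ^ 2 ≤ (4 * (a * b - f ^ 2)) ^ 2 :=
      pow_le_pow_left₀ (by positivity) h1 2
    have h5 : 27 * a ^ 4 ≤ 64 * a := by nlinarith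
    have h6 : 8 ≤ a ^ 3 := by
      have := pow_le_pow_left₀ (by norm_num) h3 3
      linarith
    nlinarith
  subst ha1
  have hDD : 1 * b - f ^ 2 = 1 := by nlinarith
  have hb : b = 1 + f ^ 2 := by linarith
  subst hb
  refine ⟨x + f * y + e * z, y + (d - e * f) * z, z, ?_⟩
  linear_combination z ^ 2 * hdet

lemma aux_three (n : ℕ) (hn : n % 4 = 2) : ∃ l m k : ℤ, (n : ℤ) = l ^ 2 + m ^ 2 + k ^ 2 := by
  have hcop : (n - 1).Coprime (4 * n) := by
    apply Nat.Coprime.mul_right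
    · have : (n - 1).Coprime (2 ^ 2) := by
        apply Nat.Coprime.pow_right
        rw [Nat.coprime_two_right]
        exact ⟨(n - 2) / 2, by omega⟩
      simpa using this
    · have h : n = (n - 1) + 1 := by omega
      have h' : (n - 1).Coprime ((n - 1) + 1) := by simp
      rwa [← h] at h'
  obtain ⟨p, hpn, hp, hmod⟩ := Nat.forall_exists_prime_gt_and_modEq n
    (show 4 * n ≠ 0 by omega) hcop
  have hdvd := (Nat.modEq_iff_dvd' (by omega)).1 hmod.symm
  obtain ⟨v, hv⟩ := hdvd
  have hpe : p = (4 * v + 1) * n - 1 := by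
    have : (4 * v + 1) * n = 4 * n * v + n := by ring
    omega
  have hpe' : (4 * v + 1) * n = p + 1 := by
    have : 0 < (4 * v + 1) * n := Nat.mul_pos (by omega) (by omega)
    omega
  have hp4 : p % 4 = 1 := by
    have : p = 4 * (n * v) + (n - 1) := by
      rw [← mul_assoc]; omega
    omega
  haveI : Fact p.Prime := ⟨hp⟩
  have hβ4 : (4 * v + 1) % 4 = 1 := by omega
  have hoddp : Odd p := Nat.odd_iff.2 (by omega)
  have hoddβ : Odd (4 * v + 1) := Nat.odd_iff.2 (by omega)
  have hJ : jacobiSym (-((4 * v + 1 : ℕ) : ℤ)) p = 1 := by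
    rw [jacobiSym.neg _ hoddp, ZMod.χ₄_nat_one_mod_four hp4, one_mul,
      jacobiSym.quadratic_reciprocity_one_mod_four hβ4 hoddp]
    have : jacobiSym (p : ℤ) (4 * v + 1) = jacobiSym (-1) (4 * v + 1) := by
      apply jacobiSym.mod_left'
      apply Int.ModEq.symm
      rw [Int.modEq_iff_dvd]
      refine ⟨n, ?_⟩
      have : (((4 * v + 1) * n : ℕ) : ℤ) = p + 1 := by exact_mod_cast hpe'
      rw [Nat.cast_mul] at this
      linarith
    rw [this, jacobiSym.at_neg_one hoddβ, ZMod.χ₄_nat_one_mod_four hβ4]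
  rw [← jacobiSym.legendreSym.to_jacobiSym] at hJ
  have hne : ((-((4 * v + 1 : ℕ) : ℤ) : ℤ) : ZMod p) ≠ 0 := by
    intro h
    rw [← legendreSym.eq_zero_iff] at h
    omega
  rw [legendreSym.eq_one_iff p hne] at hJ
  obtain ⟨t, ht⟩ := hJ
  obtain ⟨s, rfl⟩ := ZMod.intCast_surjective t
  have hd : (p : ℤ) ∣ s ^ 2 + (4 * v + 1 : ℕ) := by
    rw [← ZMod.intCast_zmod_eq_zero_iff_dvd]
    rw [Int.cast_neg] at ht
    rw [Int.cast_add, Int.cast_pow, pow_two, ← ht]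
    ring
  obtain ⟨a, ha⟩ := hd
  have hppos : (0 : ℤ) < p := by exact_mod_cast hp.pos
  have hc : ((4 * v + 1 : ℕ) : ℤ) * n = p + 1 := by exact_mod_cast hpe'
  have hβpos : (0 : ℤ) < ((4 * v + 1 : ℕ) : ℤ) := by positivity
  generalize ((4 * v + 1 : ℕ) : ℤ) = β at *
  have hapos : 0 < a := by
    have : 0 < (p : ℤ) * a := by rw [← ha]; positivity
    exact pos_of_mul_pos_right this hppos.le
  have hD : a * p - s ^ 2 = β := by linarith
  obtain ⟨l, m, k, h⟩ := aux_reduce a.toNat β.toNat a p n 0 1 s (by omega) (by omega) hapos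
    (by omega) (by linear_combination n * hD + hc) 0 0 1
  exact ⟨l, m, k, by linarith⟩

lemma aux_final (N l m n : ℤ) (h : 2 * N = l ^ 2 + m ^ 2 + n ^ 2) (hlm : 2 ∣ l - m) (hn : 2 ∣ n) :
    ∃ l m n : ℤ, N = l ^ 2 + m ^ 2 + 2 * n ^ 2 := by
  obtain ⟨u, hu⟩ := hlm
  obtain ⟨w, rfl⟩ := hn
  obtain rfl : l = m + 2 * u := by linarith
  exact ⟨m + u, u, w, by linarith⟩

theorem stmt4 (N : ℤ) (hpos : 0 < N) (hodd : Odd N) :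
    ∃ l m n : ℤ, N = l ^ 2 + m ^ 2 + 2 * n ^ 2 := by
  obtain ⟨r, hr⟩ := hodd
  obtain ⟨l, m, n, h⟩ := aux_three (2 * N).toNat (by omega)
  rw [Int.toNat_of_nonneg (by omega)] at h
  rcases Int.even_or_odd' l with ⟨x, hx | hx⟩ <;> rcases Int.even_or_odd' m with ⟨y, hy | hy⟩ <;>
    rcases Int.even_or_odd' n with ⟨z, hz | hz⟩
  · exact aux_final N l m n h (by omega) (by omega)
  · exfalso; subst hx hy hz; ring_nf at h; omega
  · exfalso; subst hx hy hz; ring_nf at h; omega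
  · exact aux_final N m n l (by linarith) (by omega) (by omega)
  · exfalso; subst hx hy hz; ring_nf at h; omega
  · exact aux_final N l n m (by linarith) (by omega) (by omega)
  · exact aux_final N l m n h (by omega) (by omega)
  · exfalso; subst hx hy hz; ring_nf at h; omega
end

section
/- For each non-negative integer N the following hold: pG(2,1,1;6N) = rP(1,1,2;N); pG(2,1,1;6N+1) = 2·rtp(3,2,1;N); pG(2,1,1;6N+2) = 2·rtp(1,3,2;N); pG(2,1,1;6N+3) = 2·tpg(2,1,1;N); pG(2,1,1;6N+4) = 2·rtp(1,6,1;N); and pG(2,1,1;6N+5) = 4·Tg(2,3,1;N). -/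
/-- Enumerates the integers as two copies of the naturals, `n` and `-1-n`. -/
def sgn (b : Bool) (n : ℕ) : ℤ := if b then n else -1 - n

lemma count_lemma {ι δ : Type*} [Fintype ι] (T : Set δ) (S : Set (ℤ × ℤ × ℤ))
    (F : ι → δ → ℤ × ℤ × ℤ)
    (hinj : ∀ i d i' d', F i d = F i' d' → i = i' ∧ d = d')
    (hmem : ∀ i d, F i d ∈ S ↔ d ∈ T)
    (hsurj : ∀ x ∈ S, ∃ i d, F i d = x) : S.ncard = Fintype.card ι * T.ncard := by
  have h : S = (fun p : ι × δ => F p.1 p.2) '' (Set.univ ×ˢ T) := by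
    ext x
    constructor
    · intro hx
      obtain ⟨i, d, rfl⟩ := hsurj x hx
      exact ⟨(i, d), ⟨Set.mem_univ _, (hmem i d).1 hx⟩, rfl⟩
    · rintro ⟨⟨i, d⟩, ⟨-, hd⟩, rfl⟩
      exact (hmem i d).2 hd
  rw [h, Set.ncard_image_of_injective, Set.ncard_prod, Set.ncard_univ, Nat.card_eq_fintype_card]
  rintro ⟨i, d⟩ ⟨i', d'⟩ hh
  obtain ⟨h1, h2⟩ := hinj _ _ _ _ hh
  exact Prod.ext h1 h2

lemma sgn_surj (k : ℤ) : ∃ b n, sgn b n = k := by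
  rcases le_or_gt 0 k with h | h
  · exact ⟨true, k.toNat, by simp [sgn, h]⟩
  · exact ⟨false, (-1 - k).toNat, by simp [sgn]; omega⟩

lemma sgn_inj {b b' : Bool} {n n' : ℕ} (h : sgn b n = sgn b' n') : b = b' ∧ n = n' := by
  cases b <;> cases b' <;> simp [sgn] at h ⊢ <;> omega

lemma two_tri (n : ℕ) (b : Bool) : 2 * (tri n : ℤ) = sgn b n * (sgn b n + 1) := by
  have h : 2 * tri n = n * (n + 1) := by
    unfold tri
    exact Nat.mul_div_cancel' (Nat.even_mul_succ_self n).two_dvd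
  have h' : 2 * (tri n : ℤ) = n * (n + 1) := by exact_mod_cast h
  cases b <;> simp [sgn, h'] ; ring

lemma two_pent (n : ℤ) : 2 * pent n = n * (3 * n + 1) := by
  unfold pent
  apply Int.mul_ediv_cancel'
  rcases Int.even_or_odd' n with ⟨k, rfl | rfl⟩
  · exact ⟨k * (6 * k + 1), by ring⟩
  · exact ⟨(2 * k + 1) * (3 * k + 2), by ring⟩

lemma sq_par (n : ℤ) : ∃ a, n * n = n + 2 * a := by
  rcases Int.even_or_odd' n with ⟨k, rfl | rfl⟩
  · exact ⟨2 * k * k - k, by ring⟩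
  · exact ⟨2 * k * k + k, by ring⟩

/-- The set counted by `pGCount 2 1 1 M`, and the residue of `M` modulo 6. -/
lemma lin_res {M l m n : ℤ}
    (h : M = ((2 : ℕ) : ℤ) * pent l + ((1 : ℕ) : ℤ) * oct m + ((1 : ℕ) : ℤ) * oct n) :
    ∃ q, M = 4 * l + 5 * m + 5 * n + 6 * q := by
  obtain ⟨a, ha⟩ := sq_par l
  obtain ⟨b, hb⟩ := sq_par m
  obtain ⟨c, hc⟩ := sq_par n
  have hl := two_pent l
  refine ⟨a + b + c, ?_⟩
  unfold oct at h
  push_cast at h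
  linear_combination h + hl + 3 * ha + 3 * hb + 3 * hc

lemma case0 (N : ℕ) : pGCount 2 1 1 (6 * N : ℤ) = rPCount 1 1 2 (N : ℤ) := by
  have key := count_lemma
    {x : ℤ × ℤ × ℤ | (N : ℤ) = ((1 : ℕ) : ℤ) * x.1 ^ 2 + ((1 : ℕ) : ℤ) * pent x.2.1 + ((2 : ℕ) : ℤ) * pent x.2.2}
    {x : ℤ × ℤ × ℤ | (6 * N : ℤ) = ((2 : ℕ) : ℤ) * pent x.1 + ((1 : ℕ) : ℤ) * oct x.2.1 + ((1 : ℕ) : ℤ) * oct x.2.2}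
    (fun (i : Unit) d => match i, d with | ⟨⟩, ⟨k, p, g⟩ => (2 * g - p, p + g + k, p + g - k)) ?_ ?_ ?_
  · simpa [pGCount, rPCount] using key
  · rintro ⟨⟩ ⟨k, p, g⟩ ⟨⟩ ⟨k', p', g'⟩ h
    simp only [Prod.mk.injEq] at h
    obtain ⟨h1, h2, h3⟩ := h
    obtain rfl : k = k' := by omega
    obtain rfl : p = p' := by omega
    obtain rfl : g = g' := by omega
    exact ⟨rfl, rfl⟩
  · rintro ⟨⟩ ⟨k, p, g⟩
    simp only [Set.mem_ofPred_eq, oct]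
    have hl := two_pent (2 * g - p)
    have hpp := two_pent p
    have hpg := two_pent g
    push_cast
    ring_nf at *
    constructor <;> intro h <;> linarith
  · rintro ⟨l, m, n⟩ hx
    obtain ⟨q, hq⟩ := lin_res hx
    dsimp only at hq
    obtain ⟨k, p, g, e1, e2, e3⟩ : ∃ k p g : ℤ, 2 * g - p = l ∧ p + g + k = m ∧ p + g - k = n :=
      ⟨(m - n) / 2, ((2 * m + 2 * n - 2 * l + 1) - 1) / 6, (-(-2 * l - 1 - m - n) - 1) / 6, by omega, by omega, by omega⟩
    exact ⟨⟨⟩, ⟨k, p, g⟩, by simp only [e1, e2, e3]⟩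

lemma case1 (N : ℕ) : pGCount 2 1 1 (6 * N + 1 : ℤ) = 2 * rtpCount 3 2 1 (N : ℤ) := by
  have key := count_lemma
    {x : ℤ × ℕ × ℤ | (N : ℤ) = ((3 : ℕ) : ℤ) * x.1 ^ 2 + ((2 : ℕ) : ℤ) * tri x.2.1 + ((1 : ℕ) : ℤ) * pent x.2.2}
    {x : ℤ × ℤ × ℤ | (6 * N + 1 : ℤ) = ((2 : ℕ) : ℤ) * pent x.1 + ((1 : ℕ) : ℤ) * oct x.2.1 + ((1 : ℕ) : ℤ) * oct x.2.2}
    (fun (i : Bool) d => match i, d with | b, ⟨c, j, p⟩ => (p - 2 * c, -p - c + (sgn b j), -p - c - (sgn b j) - 1)) ?_ ?_ ?_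
  · simpa [pGCount, rtpCount] using key
  · rintro b ⟨c, j, p⟩ b' ⟨c', j', p'⟩ h
    simp only [Prod.mk.injEq] at h
    obtain ⟨h1, h2, h3⟩ := h
    have ej : sgn b j = sgn b' j' := by omega
    obtain ⟨rfl, rfl⟩ := sgn_inj ej
    obtain rfl : c = c' := by omega
    obtain rfl : p = p' := by omega
    exact ⟨rfl, rfl⟩
  · rintro b ⟨c, j, p⟩
    simp only [Set.mem_ofPred_eq, oct]
    have hl := two_pent (p - 2 * c)
    have hpp := two_pent p
    have htj := two_tri j b
    generalize sgn b j = zj at *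
    push_cast
    ring_nf at *
    constructor <;> intro h <;> linarith
  · rintro ⟨l, m, n⟩ hx
    obtain ⟨q, hq⟩ := lin_res hx
    dsimp only at hq
    obtain ⟨c, p, zj, e1, e2, e3⟩ : ∃ c p zj : ℤ, p - 2 * c = l ∧ -p - c + zj = m ∧ -p - c - zj - 1 = n :=
      ⟨(-2 * l - 1 - m - n) / 6, (-(2 * m + 2 * n - 2 * l + 1) - 1) / 6, ((m - n) - 1) / 2, by omega, by omega, by omega⟩
    obtain ⟨b, j, rfl⟩ := sgn_surj zj
    exact ⟨b, ⟨c, j, p⟩, by simp only [e1, e2, e3]⟩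

lemma case2 (N : ℕ) : pGCount 2 1 1 (6 * N + 2 : ℤ) = 2 * rtpCount 1 3 2 (N : ℤ) := by
  have key := count_lemma
    {x : ℤ × ℕ × ℤ | (N : ℤ) = ((1 : ℕ) : ℤ) * x.1 ^ 2 + ((3 : ℕ) : ℤ) * tri x.2.1 + ((2 : ℕ) : ℤ) * pent x.2.2}
    {x : ℤ × ℤ × ℤ | (6 * N + 2 : ℤ) = ((2 : ℕ) : ℤ) * pent x.1 + ((1 : ℕ) : ℤ) * oct x.2.1 + ((1 : ℕ) : ℤ) * oct x.2.2}
    (fun (i : Bool) d => match i, d with | b, ⟨k, j, c⟩ => (-(sgn b j) - 2 * c - 1, (sgn b j) - c + k, (sgn b j) - c - k)) ?_ ?_ ?_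
  · simpa [pGCount, rtpCount] using key
  · rintro b ⟨k, j, c⟩ b' ⟨k', j', c'⟩ h
    simp only [Prod.mk.injEq] at h
    obtain ⟨h1, h2, h3⟩ := h
    have ej : sgn b j = sgn b' j' := by omega
    obtain ⟨rfl, rfl⟩ := sgn_inj ej
    obtain rfl : k = k' := by omega
    obtain rfl : c = c' := by omega
    exact ⟨rfl, rfl⟩
  · rintro b ⟨k, j, c⟩
    simp only [Set.mem_ofPred_eq, oct]
    have hl := two_pent (-(sgn b j) - 2 * c - 1)
    have hpc := two_pent c
    have htj := two_tri j b
    generalize sgn b j = zj at *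
    push_cast
    ring_nf at *
    constructor <;> intro h <;> linarith
  · rintro ⟨l, m, n⟩ hx
    obtain ⟨q, hq⟩ := lin_res hx
    dsimp only at hq
    obtain ⟨k, c, zj, e1, e2, e3⟩ : ∃ k c zj : ℤ, -zj - 2 * c - 1 = l ∧ zj - c + k = m ∧ zj - c - k = n :=
      ⟨(m - n) / 2, ((-2 * l - 1 - m - n) - 1) / 6, ((2 * m + 2 * n - 2 * l + 1) - 3) / 6, by omega, by omega, by omega⟩
    obtain ⟨b, j, rfl⟩ := sgn_surj zj
    exact ⟨b, ⟨k, j, c⟩, by simp only [e1, e2, e3]⟩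

lemma case3 (N : ℕ) : pGCount 2 1 1 (6 * N + 3 : ℤ) = 2 * tpgCount 2 1 1 (N : ℤ) := by
  have key := count_lemma
    {x : ℕ × ℤ × ℤ | (N : ℤ) = ((2 : ℕ) : ℤ) * tri x.1 + ((1 : ℕ) : ℤ) * pent x.2.1 + ((1 : ℕ) : ℤ) * oct x.2.2}
    {x : ℤ × ℤ × ℤ | (6 * N + 3 : ℤ) = ((2 : ℕ) : ℤ) * pent x.1 + ((1 : ℕ) : ℤ) * oct x.2.1 + ((1 : ℕ) : ℤ) * oct x.2.2}
    (fun (i : Bool) d => match i, d with | b, ⟨j, p, g⟩ => (-p - 2 * g - 1, p - g + (sgn b j), p - g - (sgn b j) - 1)) ?_ ?_ ?_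
  · simpa [pGCount, tpgCount] using key
  · rintro b ⟨j, p, g⟩ b' ⟨j', p', g'⟩ h
    simp only [Prod.mk.injEq] at h
    obtain ⟨h1, h2, h3⟩ := h
    have ej : sgn b j = sgn b' j' := by omega
    obtain ⟨rfl, rfl⟩ := sgn_inj ej
    obtain rfl : p = p' := by omega
    obtain rfl : g = g' := by omega
    exact ⟨rfl, rfl⟩
  · rintro b ⟨j, p, g⟩
    simp only [Set.mem_ofPred_eq, oct]
    have hl := two_pent (-p - 2 * g - 1)
    have hpp := two_pent p
    have htj := two_tri j b
    generalize sgn b j = zj at *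
    push_cast
    ring_nf at *
    constructor <;> intro h <;> linarith
  · rintro ⟨l, m, n⟩ hx
    obtain ⟨q, hq⟩ := lin_res hx
    dsimp only at hq
    obtain ⟨p, g, zj, e1, e2, e3⟩ : ∃ p g zj : ℤ, -p - 2 * g - 1 = l ∧ p - g + zj = m ∧ p - g - zj - 1 = n :=
      ⟨((2 * m + 2 * n - 2 * l + 1) - 1) / 6, ((-2 * l - 1 - m - n) - 2) / 6, ((m - n) - 1) / 2, by omega, by omega, by omega⟩
    obtain ⟨b, j, rfl⟩ := sgn_surj zj
    exact ⟨b, ⟨j, p, g⟩, by simp only [e1, e2, e3]⟩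

lemma case4 (N : ℕ) : pGCount 2 1 1 (6 * N + 4 : ℤ) = 2 * rtpCount 1 6 1 (N : ℤ) := by
  have key := count_lemma
    {x : ℤ × ℕ × ℤ | (N : ℤ) = ((1 : ℕ) : ℤ) * x.1 ^ 2 + ((6 : ℕ) : ℤ) * tri x.2.1 + ((1 : ℕ) : ℤ) * pent x.2.2}
    {x : ℤ × ℤ × ℤ | (6 * N + 4 : ℤ) = ((2 : ℕ) : ℤ) * pent x.1 + ((1 : ℕ) : ℤ) * oct x.2.1 + ((1 : ℕ) : ℤ) * oct x.2.2}
    (fun (i : Bool) d => match i, d with | b, ⟨k, j, p⟩ => (p - 2 * (sgn b j) - 1, -p - (sgn b j) - 1 + k, -p - (sgn b j) - 1 - k)) ?_ ?_ ?_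
  · simpa [pGCount, rtpCount] using key
  · rintro b ⟨k, j, p⟩ b' ⟨k', j', p'⟩ h
    simp only [Prod.mk.injEq] at h
    obtain ⟨h1, h2, h3⟩ := h
    have ej : sgn b j = sgn b' j' := by omega
    obtain ⟨rfl, rfl⟩ := sgn_inj ej
    obtain rfl : k = k' := by omega
    obtain rfl : p = p' := by omega
    exact ⟨rfl, rfl⟩
  · rintro b ⟨k, j, p⟩
    simp only [Set.mem_ofPred_eq, oct]
    have hl := two_pent (p - 2 * (sgn b j) - 1)
    have hpp := two_pent p
    have htj := two_tri j b
    generalize sgn b j = zj at *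
    push_cast
    ring_nf at *
    constructor <;> intro h <;> linarith
  · rintro ⟨l, m, n⟩ hx
    obtain ⟨q, hq⟩ := lin_res hx
    dsimp only at hq
    obtain ⟨k, p, zj, e1, e2, e3⟩ : ∃ k p zj : ℤ, p - 2 * zj - 1 = l ∧ -p - zj - 1 + k = m ∧ -p - zj - 1 - k = n :=
      ⟨(m - n) / 2, (-(2 * m + 2 * n - 2 * l + 1) - 1) / 6, ((-2 * l - 1 - m - n) - 3) / 6, by omega, by omega, by omega⟩
    obtain ⟨b, j, rfl⟩ := sgn_surj zj
    exact ⟨b, ⟨k, j, p⟩, by simp only [e1, e2, e3]⟩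

lemma case5 (N : ℕ) : pGCount 2 1 1 (6 * N + 5 : ℤ) = 4 * TgCount 2 3 1 (N : ℤ) := by
  have key := count_lemma
    {x : ℕ × ℕ × ℤ | (N : ℤ) = ((2 : ℕ) : ℤ) * tri x.1 + ((3 : ℕ) : ℤ) * tri x.2.1 + ((1 : ℕ) : ℤ) * oct x.2.2}
    {x : ℤ × ℤ × ℤ | (6 * N + 5 : ℤ) = ((2 : ℕ) : ℤ) * pent x.1 + ((1 : ℕ) : ℤ) * oct x.2.1 + ((1 : ℕ) : ℤ) * oct x.2.2}
    (fun (i : Bool × Bool) d => match i, d with | ⟨b, a⟩, ⟨j, i, g⟩ => (2 * g - (sgn a i), (sgn a i) + g + (sgn b j) + 1, (sgn a i) + g - (sgn b j))) ?_ ?_ ?_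
  · simpa [pGCount, TgCount] using key
  · rintro ⟨b, a⟩ ⟨j, i, g⟩ ⟨b', a'⟩ ⟨j', i', g'⟩ h
    simp only [Prod.mk.injEq] at h
    obtain ⟨h1, h2, h3⟩ := h
    have ej : sgn b j = sgn b' j' := by omega
    obtain ⟨rfl, rfl⟩ := sgn_inj ej
    have ei : sgn a i = sgn a' i' := by omega
    obtain ⟨rfl, rfl⟩ := sgn_inj ei
    obtain rfl : g = g' := by omega
    exact ⟨rfl, rfl⟩
  · rintro ⟨b, a⟩ ⟨j, i, g⟩
    simp only [Set.mem_ofPred_eq, oct]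
    have hl := two_pent (2 * g - (sgn a i))
    have htj := two_tri j b
    generalize sgn b j = zj at *
    have hti := two_tri i a
    generalize sgn a i = zi at *
    push_cast
    ring_nf at *
    constructor <;> intro h <;> linarith
  · rintro ⟨l, m, n⟩ hx
    obtain ⟨q, hq⟩ := lin_res hx
    dsimp only at hq
    obtain ⟨g, zj, zi, e1, e2, e3⟩ : ∃ g zj zi : ℤ, 2 * g - zi = l ∧ zi + g + zj + 1 = m ∧ zi + g - zj = n :=
      ⟨(-(-2 * l - 1 - m - n) - 2) / 6, ((m - n) - 1) / 2, ((2 * m + 2 * n - 2 * l + 1) - 3) / 6, by omega, by omega, by omega⟩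
    obtain ⟨b, j, rfl⟩ := sgn_surj zj
    obtain ⟨a, i, rfl⟩ := sgn_surj zi
    exact ⟨⟨b, a⟩, ⟨j, i, g⟩, by simp only [e1, e2, e3]⟩

theorem stmt14 (N : ℕ) :
    pGCount 2 1 1 (6 * N : ℤ) = rPCount 1 1 2 (N : ℤ) ∧
    pGCount 2 1 1 (6 * N + 1 : ℤ) = 2 * rtpCount 3 2 1 (N : ℤ) ∧
    pGCount 2 1 1 (6 * N + 2 : ℤ) = 2 * rtpCount 1 3 2 (N : ℤ) ∧
    pGCount 2 1 1 (6 * N + 3 : ℤ) = 2 * tpgCount 2 1 1 (N : ℤ) ∧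
    pGCount 2 1 1 (6 * N + 4 : ℤ) = 2 * rtpCount 1 6 1 (N : ℤ) ∧
    pGCount 2 1 1 (6 * N + 5 : ℤ) = 4 * TgCount 2 3 1 (N : ℤ) := by
  exact ⟨case0 N, case1 N, case2 N, case3 N, case4 N, case5 N⟩
end
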